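/- arXiv:1303.2319 — 6 statements merged into one kernel-verified Lean document; each statement's English description precedes it below -/
import Mathlib

section
/- Given a real constant C > 0 and real numbers λ₁, λ₂ with 0 < λ₁ < λ₂ < 1, there exists a natural number N = N(C, λ₁, λ₂) such that: for every sequence of real numbers (a_n)_{n≥1} satisfying ∑_{i=1}^{n} a_i ≤ C + n·λ₁ for all n ≥ 1, there exists a natural number L ≤ N such that ∑_{i=1}^{n} a_{L+i} ≤ n·λ₂ for all n ≥ 1. -/
/-- Pliss-type lemma (Lemma 2.2): given `C > 0` and `0 < λ₁ < λ₂ < 1`, there is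
`N = N(C, λ₁, λ₂)` such that any real sequence `(a_n)_{n ≥ 1}` whose partial sums satisfy
`∑_{i=1}^n a_i ≤ C + n·λ₁` for all `n ≥ 1` admits a shift `L ≤ N` with
`∑_{i=1}^n a_{L+i} ≤ n·λ₂` for all `n ≥ 1`. -/
theorem pliss_lemma_uniform_bound (C lam₁ lam₂ : ℝ) (hC : 0 < C)
    (h₁ : 0 < lam₁) (h₁₂ : lam₁ < lam₂) (h₂ : lam₂ < 1) :
    ∃ N : ℕ, ∀ a : ℕ → ℝ,
      (∀ n : ℕ, 1 ≤ n → ∑ i ∈ Finset.Icc 1 n, a i ≤ C + n * lam₁) →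
      ∃ L : ℕ, L ≤ N ∧ ∀ n : ℕ, 1 ≤ n →
        ∑ i ∈ Finset.Icc 1 n, a (L + i) ≤ n * lam₂ := by
  have hd : 0 < lam₂ - lam₁ := by linarith
  obtain ⟨N, hN⟩ := exists_nat_ge (C / (lam₂ - lam₁))
  rw [div_le_iff₀ hd] at hN
  refine ⟨N, fun a ha => ?_⟩
  obtain ⟨L, hL, hmax⟩ := Finset.exists_max_image (Finset.range (N + 1))
    (fun n : ℕ => ∑ i ∈ Finset.Icc 1 n, a i - n * lam₂) ⟨0, by simp⟩
  have key : ∀ n : ℕ, ∑ i ∈ Finset.Icc 1 n, a (L + i)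
      = ∑ i ∈ Finset.Icc 1 (L + n), a i - ∑ i ∈ Finset.Icc 1 L, a i := by
    intro n
    induction n with
    | zero => simp
    | succ k ih =>
      rw [Finset.sum_Icc_succ_top (by omega), ih, ← add_assoc L k 1,
        Finset.sum_Icc_succ_top (by omega)]
      ring
  refine ⟨L, by simpa [Nat.lt_succ_iff] using hL, fun n hn => ?_⟩
  rw [key]
  have h0 := hmax 0 (by simp)
  simp only [Nat.cast_zero, zero_mul, sub_zero, Finset.Icc_eq_empty_of_lt Nat.zero_lt_one,
    Finset.sum_empty] at h0
  by_cases hle : L + n ≤ N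
  · have h := hmax (L + n) (by simp; omega)
    push_cast at h
    linarith
  · have h := ha (L + n) (by omega)
    have hc : (N : ℝ) ≤ (L : ℝ) + n := by exact_mod_cast (by omega : N ≤ L + n)
    have := mul_le_mul_of_nonneg_right hc hd.le
    push_cast at h
    linarith
end

section
/- Let C > 0 and let λ₁, λ₂ be real numbers with 0 < λ₁ < λ₂ < 1. If a sequence of real numbers (a_n)_{n≥1} satisfies ∑_{i=1}^{n} a_i ≤ C + n·λ₁ for all n ≥ 1, then there exists a natural number m such that ∑_{i=1}^{n} a_{m+i} ≤ n·λ₂ for all n ≥ 1. -/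
/-- First step of the Pliss-type lemma (Lemma 2.2): given `C > 0` and `0 < λ₁ < λ₂ < 1`,
any real sequence `(a_n)_{n ≥ 1}` with `∑_{i=1}^n a_i ≤ C + n·λ₁` for all `n ≥ 1`
admits some shift `m` with `∑_{i=1}^n a_{m+i} ≤ n·λ₂` for all `n ≥ 1`. -/
theorem pliss_time_exists (C lam₁ lam₂ : ℝ) (hC : 0 < C)
    (h₁ : 0 < lam₁) (h₁₂ : lam₁ < lam₂) (h₂ : lam₂ < 1) (a : ℕ → ℝ)
    (ha : ∀ n : ℕ, 1 ≤ n → ∑ i ∈ Finset.Icc 1 n, a i ≤ C + n * lam₁) :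
    ∃ m : ℕ, ∀ n : ℕ, 1 ≤ n →
      ∑ i ∈ Finset.Icc 1 n, a (m + i) ≤ n * lam₂ := by
  by_contra! hcon
  have split : ∀ m n : ℕ, ∑ i ∈ Finset.Icc 1 (m + n), a i
      = ∑ i ∈ Finset.Icc 1 m, a i + ∑ i ∈ Finset.Icc 1 n, a (m + i) := by
    intro m n
    induction n with
    | zero => simp
    | succ n ih =>
      rw [← add_assoc, Finset.sum_Icc_succ_top (by omega), ih,
        Finset.sum_Icc_succ_top (by omega), add_assoc m n 1, add_assoc]
  have key : ∀ k : ℕ, ∃ N : ℕ, k ≤ N ∧ (N : ℝ) * lam₂ ≤ ∑ i ∈ Finset.Icc 1 N, a i := by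
    intro k
    induction k with
    | zero => exact ⟨0, le_rfl, by simp⟩
    | succ k ih =>
      obtain ⟨N, hkN, hN⟩ := ih
      obtain ⟨n, hn, hs⟩ := hcon N
      refine ⟨N + n, by omega, ?_⟩
      rw [split]
      push_cast
      linarith
  obtain ⟨k, hk⟩ := exists_nat_gt (C / (lam₂ - lam₁))
  obtain ⟨N, hkN, hN⟩ := key (k + 1)
  have hb := ha N (by omega)
  rw [div_lt_iff₀ (by linarith)] at hk
  have hkN' : (k : ℝ) ≤ N := by exact_mod_cast (by omega : k ≤ N)
  have := mul_le_mul_of_nonneg_right hkN' (by linarith : 0 ≤ lam₂ - lam₁)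
  linarith
end

section
/- Let (a_n)_{n≥1} be a sequence of real numbers and λ₂ a real number. If for every natural number j there exists n_j ≥ 1 such that ∑_{i=1}^{n_j} a_{j+i} ≥ n_j·λ₂, then limsup_{n→∞} (1/n)·∑_{i=1}^{n} a_i ≥ λ₂. -/
open Filter

theorem sum_Icc_add_shift (a : ℕ → ℝ) (m n : ℕ) :
    ∑ i ∈ Finset.Icc 1 (m + n), a i
      = ∑ i ∈ Finset.Icc 1 m, a i + ∑ i ∈ Finset.Icc 1 n, a (m + i) := by
  induction n with
  | zero => simp
  | succ n ih =>
    rw [← add_assoc, Finset.sum_Icc_succ_top (by omega), Finset.sum_Icc_succ_top (by omega), ih]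
    simp only [add_assoc]

/-- Step in the proof of the Pliss-type lemma (Lemma 2.2): if for every shift `j` there is
`n_j ≥ 1` with `∑_{i=1}^{n_j} a_{j+i} ≥ n_j·λ₂`, then the limsup of the Cesàro averages
`(1/n)·∑_{i=1}^n a_i` is at least `λ₂`. -/
theorem limsup_avg_ge_of_forall_shift_exists (a : ℕ → ℝ) (lam₂ : ℝ)
    (h : ∀ j : ℕ, ∃ n : ℕ, 1 ≤ n ∧ (n : ℝ) * lam₂ ≤ ∑ i ∈ Finset.Icc 1 n, a (j + i)) :
    (lam₂ : EReal) ≤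
      Filter.limsup (fun n : ℕ => (((∑ i ∈ Finset.Icc 1 n, a i) / n : ℝ) : EReal))
        Filter.atTop := by
  have key : ∀ N : ℕ, ∃ m : ℕ, N ≤ m ∧ (m : ℝ) * lam₂ ≤ ∑ i ∈ Finset.Icc 1 m, a i := by
    intro N
    induction N with
    | zero => exact ⟨0, le_refl _, by simp⟩
    | succ N ih =>
      obtain ⟨m, hm, hs⟩ := ih
      obtain ⟨n, hn, hs2⟩ := h m
      refine ⟨m + n, by omega, ?_⟩
      rw [sum_Icc_add_shift]
      push_cast
      linarith
  refine Filter.le_limsup_of_frequently_le ?_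
  rw [Filter.frequently_atTop]
  intro N
  obtain ⟨m, hm, hs⟩ := key (N + 1)
  refine ⟨m, by omega, ?_⟩
  have hpos : (0 : ℝ) < m := by
    have : 0 < m := by omega
    exact_mod_cast this
  rw [EReal.coe_le_coe_iff, le_div_iff₀ hpos]
  linarith
end

section
/- Let (a_n)_{n≥1} be a sequence of real numbers and λ₂ a real number. Say that a natural number m has property P if ∑_{i=1}^{n} a_{m+i} ≤ n·λ₂ for all n ≥ 1. Suppose m ≥ 1 has property P and no natural number m' < m has property P. Then for every j with 1 ≤ j ≤ m one has ∑_{i=j}^{m} a_i > (m − j + 1)·λ₂; in particular a_m > λ₂ and ∑_{i=1}^{m} a_i > m·λ₂. -/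
theorem pliss_aux_shift (a : ℕ → ℝ) (k n : ℕ) :
    ∑ i ∈ Finset.Icc 1 n, a (k + i)
      = ∑ i ∈ Finset.Icc 1 (k + n), a i - ∑ i ∈ Finset.Icc 1 k, a i := by
  induction n with
  | zero => simp
  | succ n ih =>
    rw [Finset.sum_Icc_succ_top (by omega), ih, ← add_assoc,
      Finset.sum_Icc_succ_top (by omega)]
    ring

theorem pliss_aux_block (a : ℕ → ℝ) (k n : ℕ) :
    ∑ i ∈ Finset.Icc (k + 1) (k + n), a i
      = ∑ i ∈ Finset.Icc 1 (k + n), a i - ∑ i ∈ Finset.Icc 1 k, a i := by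
  induction n with
  | zero => simp
  | succ n ih =>
    rw [← add_assoc, Finset.sum_Icc_succ_top (by omega), ih,
      Finset.sum_Icc_succ_top (by omega)]
    ring

/-- The inductive Claim inside the proof of the Pliss-type lemma (Lemma 2.2): if `m ≥ 1` is
minimal with the property `P m : ∀ n ≥ 1, ∑_{i=1}^n a_{m+i} ≤ n·λ₂`, then every partial sum
of the block `a_j, …, a_m` ending at `m` exceeds the corresponding multiple of `λ₂`;
in particular `a_m > λ₂` and `∑_{i=1}^m a_i > m·λ₂`. -/
theorem pliss_minimal_shift_block_sums (a : ℕ → ℝ) (lam₂ : ℝ) (m : ℕ) (hm : 1 ≤ m)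
    (hP : ∀ n : ℕ, 1 ≤ n → ∑ i ∈ Finset.Icc 1 n, a (m + i) ≤ n * lam₂)
    (hmin : ∀ m' : ℕ, m' < m →
      ¬ (∀ n : ℕ, 1 ≤ n → ∑ i ∈ Finset.Icc 1 n, a (m' + i) ≤ n * lam₂)) :
    (∀ j : ℕ, 1 ≤ j → j ≤ m →
        ((m - j + 1 : ℕ) : ℝ) * lam₂ < ∑ i ∈ Finset.Icc j m, a i) ∧
      lam₂ < a m ∧ (m : ℝ) * lam₂ < ∑ i ∈ Finset.Icc 1 m, a i := by
  have key : ∀ d k : ℕ, k + (d + 1) = m →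
      ((d + 1 : ℕ) : ℝ) * lam₂
        < ∑ i ∈ Finset.Icc 1 m, a i - ∑ i ∈ Finset.Icc 1 k, a i := by
    intro d
    induction d using Nat.strong_induction_on with
    | _ d ih =>
      intro k hk
      have h := hmin k (by omega)
      push Not at h
      obtain ⟨n, hn, h⟩ := h
      rw [pliss_aux_shift] at h
      rcases lt_trichotomy n (d + 1) with hlt | heq | hgt
      · obtain ⟨e, rfl⟩ : ∃ e, d = n + e := ⟨d - n, by omega⟩
        have h2 := ih e (by omega) (k + n) (by omega)
        push_cast at h2 ⊢
        linarith
      · subst heq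
        rw [hk] at h
        exact h
      · obtain ⟨e, rfl⟩ : ∃ e, n = (d + 1) + e := ⟨n - (d + 1), by omega⟩
        have h2 := hP e (by omega)
        rw [pliss_aux_shift] at h2
        rw [← add_assoc, hk] at h
        push_cast at h ⊢
        linarith
  have main : ∀ j : ℕ, 1 ≤ j → j ≤ m →
      ((m - j + 1 : ℕ) : ℝ) * lam₂ < ∑ i ∈ Finset.Icc j m, a i := by
    intro j hj hjm
    obtain ⟨k, rfl⟩ : ∃ k, j = k + 1 := ⟨j - 1, by omega⟩
    have h := key (m - (k + 1)) k (by omega)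
    have hb := pliss_aux_block a k (m - (k + 1) + 1)
    rw [show k + (m - (k + 1) + 1) = m by omega] at hb
    rw [hb]
    exact h
  refine ⟨main, ?_, ?_⟩
  · simpa using main m hm le_rfl
  · have h := main 1 le_rfl hm
    rwa [Nat.sub_add_cancel hm] at h
end

section
/- Let C > 0 and let λ₁ < λ₂ be real numbers. If a sequence of real numbers (a_n)_{n≥1} satisfies ∑_{i=1}^{n} a_i ≤ C + n·λ₁ for all n ≥ 1, then the set of natural numbers L such that ∑_{i=1}^{n} a_{L+i} ≤ n·λ₂ for all n ≥ 1 is infinite. -/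
/-- Infinitely many Pliss times (used in the proof of Proposition 3.6): if `C > 0`,
`λ₁ < λ₂`, and `∑_{i=1}^n a_i ≤ C + n·λ₁` for all `n ≥ 1`, then the set of `L` such that
`∑_{i=1}^n a_{L+i} ≤ n·λ₂` for all `n ≥ 1` is infinite. -/
theorem pliss_times_infinite (C lam₁ lam₂ : ℝ) (hC : 0 < C) (h₁₂ : lam₁ < lam₂)
    (a : ℕ → ℝ)
    (ha : ∀ n : ℕ, 1 ≤ n → ∑ i ∈ Finset.Icc 1 n, a i ≤ C + n * lam₁) :
    {L : ℕ | ∀ n : ℕ, 1 ≤ n →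
      ∑ i ∈ Finset.Icc 1 n, a (L + i) ≤ n * lam₂}.Infinite := by
  have key : ∀ L n : ℕ, ∑ i ∈ Finset.Icc 1 n, a (L + i)
      = ∑ i ∈ Finset.Icc 1 (L + n), a i - ∑ i ∈ Finset.Icc 1 L, a i := by
    intro L n
    induction n with
    | zero => simp
    | succ k ih =>
      rw [Finset.sum_Icc_succ_top (by omega), ih, ← add_assoc,
        Finset.sum_Icc_succ_top (by omega)]
      ring
  obtain ⟨S, hS⟩ : ∃ S : ℕ → ℝ, ∀ n, S n = ∑ i ∈ Finset.Icc 1 n, a i - n * lam₂ :=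
    ⟨_, fun _ => rfl⟩
  rw [Set.infinite_iff_exists_gt]
  intro N
  obtain ⟨M, hM⟩ := exists_nat_gt ((C - S (N + 1)) / (lam₂ - lam₁))
  have hd : 0 < lam₂ - lam₁ := sub_pos.2 h₁₂
  rw [div_lt_iff₀ hd] at hM
  obtain ⟨L, hL, hmax⟩ := Finset.exists_max_image (Finset.Icc (N + 1) (N + 1 + M)) S
    ⟨N + 1, by simp⟩
  rw [Finset.mem_Icc] at hL
  refine ⟨L, ?_, by omega⟩
  intro n hn
  have h : S (L + n) ≤ S L := by
    by_cases hc : L + n ≤ N + 1 + M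
    · exact hmax _ (by rw [Finset.mem_Icc]; omega)
    · have h1 := hmax (N + 1) (by simp)
      have h2 := ha (L + n) (by omega)
      have h3 : (M : ℝ) ≤ ((L + n : ℕ) : ℝ) := by exact_mod_cast (by omega)
      have h4 := mul_le_mul_of_nonneg_right h3 hd.le
      have h5 := hS (L + n)
      linarith
  rw [key]
  rw [hS, hS] at h
  push_cast at h
  linarith
end

section
/- Let C > 0 and let λ, λ₁ be real numbers with 0 < λ < λ₁ < 1. If (b_n)_{n≥1} is a sequence of positive real numbers satisfying ∏_{i=1}^{n} b_i ≤ C·λ^n for all n ≥ 1, then there exists an infinite strictly increasing sequence of natural numbers (L_k)_{k≥1} such that for each k, ∏_{i=1}^{n} b_{L_k + i} ≤ λ₁^n for all n ≥ 1. -/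
/-- Multiplicative form of the Pliss-type lemma, as applied in the proof of Proposition 3.6:
if `0 < λ < λ₁ < 1`, `C > 0`, and `(b_n)_{n≥1}` are positive reals with
`∏_{i=1}^n b_i ≤ C·λ^n` for all `n ≥ 1`, then there are infinitely many (a strictly
increasing sequence of) times `L_k` with `∏_{i=1}^n b_{L_k+i} ≤ λ₁^n` for all `n ≥ 1`. -/
theorem pliss_times_multiplicative (C lam lam₁ : ℝ) (hC : 0 < C)
    (hlam : 0 < lam) (hll : lam < lam₁) (hlam₁ : lam₁ < 1) (b : ℕ → ℝ)
    (hb : ∀ i : ℕ, 1 ≤ i → 0 < b i)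
    (hprod : ∀ n : ℕ, 1 ≤ n → ∏ i ∈ Finset.Icc 1 n, b i ≤ C * lam ^ n) :
    ∃ L : ℕ → ℕ, StrictMono L ∧
      ∀ k : ℕ, ∀ n : ℕ, 1 ≤ n →
        ∏ i ∈ Finset.Icc 1 n, b (L k + i) ≤ lam₁ ^ n := by
  have h1 : 0 < lam₁ := hlam.trans hll
  have hIcc : ∀ (f : ℕ → ℝ) (n : ℕ),
      ∏ i ∈ Finset.Icc 1 n, f i = ∏ i ∈ Finset.range n, f (i + 1) := by
    intro f n
    induction n with
    | zero => simp
    | succ k ih => rw [Finset.prod_Icc_succ_top (by omega), ih, Finset.prod_range_succ]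
  set Q : ℕ → ℝ := fun n => ∏ i ∈ Finset.range n, b (i + 1) with hQ
  have hQpos : ∀ n, 0 < Q n := fun n => Finset.prod_pos (fun i _ => hb _ (by omega))
  set a : ℕ → ℝ := fun n => Q n / lam₁ ^ n with ha
  have hapos : ∀ n, 0 < a n := fun n => div_pos (hQpos n) (pow_pos h1 n)
  have hlim : Filter.Tendsto (fun n : ℕ => C * (lam / lam₁) ^ n) Filter.atTop (nhds 0) := by
    have := (tendsto_pow_atTop_nhds_zero_of_lt_one (div_pos hlam h1).le
      ((div_lt_one h1).2 hll)).const_mul C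
    simpa using this
  have hmax : ∀ N, ∃ L, N ≤ L ∧ ∀ m, L ≤ m → a m ≤ a L := by
    intro N
    obtain ⟨M, hM⟩ := Filter.eventually_atTop.1 (hlim.eventually (gt_mem_nhds (hapos N)))
    obtain ⟨L, hL, hLmax⟩ := Finset.exists_max_image (Finset.Icc N (N + M)) a
      ⟨N, by simp⟩
    rw [Finset.mem_Icc] at hL
    refine ⟨L, hL.1, fun m hm => ?_⟩
    by_cases hmM : m ≤ N + M
    · exact hLmax m (Finset.mem_Icc.2 ⟨by omega, hmM⟩)
    · have h2 : a m ≤ C * (lam / lam₁) ^ m := by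
        have h3 := hprod m (by omega)
        rw [hIcc] at h3
        rw [div_pow, ← mul_div_assoc]
        exact div_le_div_of_nonneg_right h3 (pow_pos h1 m).le
      have h4 := hM m (by omega)
      have h5 := hLmax N (by simp)
      linarith
  obtain ⟨L, hL, hLp⟩ := Nat.exists_strictMono_subsequence
    (P := fun L => ∀ m, L ≤ m → a m ≤ a L) (fun N => by
      obtain ⟨L, h, h'⟩ := hmax (N + 1)
      exact ⟨L, by omega, h'⟩)
  refine ⟨L, hL, fun k n _ => ?_⟩
  have h := hLp k (L k + n) (by omega)
  rw [hIcc (fun i => b (L k + i))]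
  have hsplit : Q (L k + n) = Q (L k) * ∏ i ∈ Finset.range n, b (L k + (i + 1)) := by
    simp only [hQ, Finset.prod_range_add, add_assoc]
  simp only [ha] at h
  rw [div_le_div_iff₀ (pow_pos h1 _) (pow_pos h1 _), hsplit, pow_add] at h
  have hp := mul_pos (hQpos (L k)) (pow_pos h1 (L k))
  refine le_of_mul_le_mul_left ?_ hp
  linarith
end
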